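/- arXiv:math/0210282 — 2 statements merged into one kernel-verified Lean document; each statement's English description precedes it below -/
import Mathlib

section
/- Let α ≥ 1 be a real number and let S be a set of positive integers of polynomial density α. Then ∫_1^N π_S(t)·t^{-(1+1/α)} dt tends to infinity as N → ∞, where π_S is extended to real arguments by π_S(t) = card{p ∈ P(S) : p ≤ t}. -/
/-- The set of prime factors of elements of `S`. -/
def PrimeFactors (S : Set ℕ) : Set ℕ :=
  {p | p.Prime ∧ ∃ s ∈ S, p ∣ s}

/-- `π_S(n)`: the number of elements of `PrimeFactors S` that are `≤ n`. -/
noncomputable def primesCount (S : Set ℕ) (n : ℕ) : ℕ :=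
  ({p ∈ PrimeFactors S | p ≤ n}).ncard

/-- `S` is a set of positive integers of polynomial density `α`:
`0 ∉ S` and there is `K > 0` with `card {s ∈ S : s ≤ n} ≥ K * n^(1/α)` for all `n ≥ 1`. -/
def HasPolyDensity (S : Set ℕ) (α : ℝ) : Prop :=
  0 ∉ S ∧ ∃ K : ℝ, 0 < K ∧ ∀ n : ℕ, 0 < n →
    K * (n : ℝ) ^ (1 / α) ≤ ({s ∈ S | s ≤ n}).ncard

/-- `π_S(t)` for real `t`: the number of elements of `PrimeFactors S` that are `≤ t`. -/
noncomputable def primesCountR (S : Set ℕ) (t : ℝ) : ℕ :=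
  ({p ∈ PrimeFactors S | (p : ℝ) ≤ t}).ncard

open Filter Topology

/-- The completely multiplicative function `n ↦ n ^ (-β)` on the natural numbers. -/
noncomputable def natRpowNegHom (β : ℝ) : ℕ →* ℝ where
  toFun n := (n : ℝ) ^ (-β)
  map_one' := by simp
  map_mul' m n := by
    push_cast
    exact Real.mul_rpow (Nat.cast_nonneg m) (Nat.cast_nonneg n)

/-- A prime satisfies `p ^ (-β) ≤ 2 ^ (-β)` for `β > 0`. -/
lemma prime_rpow_neg_le {β : ℝ} (hβ : 0 < β) {p : ℕ} (hp : p.Prime) :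
    (p : ℝ) ^ (-β) ≤ (2 : ℝ) ^ (-β) :=
  Real.rpow_le_rpow_of_nonpos (by norm_num) (by exact_mod_cast hp.two_le) (by linarith)

lemma two_rpow_neg_lt_one {β : ℝ} (hβ : 0 < β) : (2 : ℝ) ^ (-β) < 1 :=
  Real.rpow_lt_one_of_one_lt_of_neg (by norm_num) (by linarith)

lemma inv_one_sub_le_exp {x q : ℝ} (hx : 0 ≤ x) (hxq : x ≤ q) (hq : q < 1) :
    (1 - x)⁻¹ ≤ Real.exp ((1 - q)⁻¹ * x) := by
  have h₁ : 0 < 1 - x := by linarith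
  have h₂ : (1 - x)⁻¹ = x * (1 - x)⁻¹ + 1 := by field_simp; ring
  have h₃ : (1 - x)⁻¹ ≤ (1 - q)⁻¹ := inv_anti₀ (by linarith) (by linarith)
  have h₄ := Real.add_one_le_exp ((1 - q)⁻¹ * x)
  nlinarith [mul_le_mul_of_nonneg_left h₃ hx]

/-- A finite sum of `n ^ (-β)` over `F`-factored numbers is at most the Euler product over `F`. -/
lemma sum_rpow_neg_le_eulerProduct {β : ℝ} (hβ : 0 < β) {F v : Finset ℕ}
    (hv : ∀ n ∈ v, n ∈ Nat.factoredNumbers F) :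
    ∑ n ∈ v, (n : ℝ) ^ (-β) ≤ ∏ p ∈ F with p.Prime, (1 - (p : ℝ) ^ (-β))⁻¹ := by
  classical
  have hnonneg : ∀ n : ℕ, 0 ≤ natRpowNegHom β n := fun n => Real.rpow_nonneg n.cast_nonneg _
  have hsum := (EulerProduct.summable_and_hasSum_factoredNumbers_prod_filter_prime_geometric
    (f := natRpowNegHom β) (fun {p} hp => by
      rw [Real.norm_of_nonneg (hnonneg p)]
      exact (prime_rpow_neg_le hβ hp).trans_lt (two_rpow_neg_lt_one hβ)) F).2
  have hle := sum_le_hasSum (v.subtype (· ∈ Nat.factoredNumbers F)) (fun m _ => hnonneg m) hsum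
  rw [Finset.sum_subtype_of_mem (fun n : ℕ => natRpowNegHom β n) hv] at hle
  exact hle

/-- If `∑ p ^ (-β)` converges over the prime factors of elements of `S`, then
`∑ s ^ (-β)` converges over `S`. -/
lemma summable_indicator_of_summable_primeFactors {β : ℝ} (hβ : 0 < β) {S : Set ℕ} (h0 : 0 ∉ S)
    (h : Summable ((PrimeFactors S).indicator fun n : ℕ => (n : ℝ) ^ (-β))) :
    Summable (S.indicator fun n : ℕ => (n : ℝ) ^ (-β)) := by
  classical
  set q : ℝ := (2 : ℝ) ^ (-β)
  have hq : q < 1 := two_rpow_neg_lt_one hβ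
  have hnonneg : ∀ n : ℕ, 0 ≤ (n : ℝ) ^ (-β) := fun n => Real.rpow_nonneg n.cast_nonneg _
  set B := ∑' n, (PrimeFactors S).indicator (fun n : ℕ => (n : ℝ) ^ (-β)) n
  refine summable_of_sum_le (c := Real.exp ((1 - q)⁻¹ * B))
    (Set.indicator_nonneg fun n _ => hnonneg n) fun u => ?_
  set v := u.filter (· ∈ S)
  set F := v.biUnion Nat.primeFactors
  have hFP : ∀ p ∈ F, p ∈ PrimeFactors S := by
    intro p hp
    obtain ⟨s, hs, hps⟩ := Finset.mem_biUnion.mp hp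
    exact ⟨Nat.prime_of_mem_primeFactors hps, s, (Finset.mem_filter.mp hs).2,
      Nat.dvd_of_mem_primeFactors hps⟩
  have hvF : ∀ s ∈ v, s ∈ Nat.factoredNumbers F := fun s hs =>
    Nat.mem_factoredNumbers_of_primeFactors_subset
      (fun hs0 => h0 (hs0 ▸ (Finset.mem_filter.mp hs).2))
      (Finset.subset_biUnion_of_mem Nat.primeFactors hs)
  calc ∑ n ∈ u, S.indicator (fun n : ℕ => (n : ℝ) ^ (-β)) n
      = ∑ n ∈ v, (n : ℝ) ^ (-β) := by
        simp only [v, Finset.sum_filter, Set.indicator_apply]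
    _ ≤ ∏ p ∈ F with p.Prime, (1 - (p : ℝ) ^ (-β))⁻¹ := sum_rpow_neg_le_eulerProduct hβ hvF
    _ ≤ ∏ p ∈ F with p.Prime, Real.exp ((1 - q)⁻¹ * (p : ℝ) ^ (-β)) := by
        refine Finset.prod_le_prod (fun p hp => ?_) fun p hp => ?_
        · have := prime_rpow_neg_le hβ (Finset.mem_filter.mp hp).2
          exact inv_nonneg.mpr (by linarith)
        · exact inv_one_sub_le_exp (hnonneg p)
            (prime_rpow_neg_le hβ (Finset.mem_filter.mp hp).2) hq
    _ = Real.exp ((1 - q)⁻¹ * ∑ p ∈ F with p.Prime, (p : ℝ) ^ (-β)) := by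
        rw [← Real.exp_sum, Finset.mul_sum]
    _ ≤ Real.exp ((1 - q)⁻¹ * B) := by
        refine Real.exp_le_exp.mpr (mul_le_mul_of_nonneg_left ?_ (inv_nonneg.mpr (by linarith)))
        calc ∑ p ∈ F with p.Prime, (p : ℝ) ^ (-β)
            = ∑ p ∈ F with p.Prime,
                (PrimeFactors S).indicator (fun n : ℕ => (n : ℝ) ^ (-β)) p :=
              Finset.sum_congr rfl fun p hp =>
                by
                rw [Set.indicator_of_mem (hFP p (Finset.mem_filter.mp hp).1)]
          _ ≤ B := h.sum_le_tsum _ fun n _ => Set.indicator_nonneg (fun n _ => hnonneg n) n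

/-- If `S` has polynomial density `α`, then `∑ s ^ (-1/α)` diverges over `S`. -/
lemma HasPolyDensity.not_summable {S : Set ℕ} {α : ℝ} (hα : 0 < α) (hS : HasPolyDensity S α) :
    ¬ Summable (S.indicator fun n : ℕ => (n : ℝ) ^ (-(1 / α))) := by
  classical
  obtain ⟨h0, K, hK, hcard⟩ := hS
  set β := 1 / α
  have hβ : 0 < β := by positivity
  intro h
  obtain ⟨s, hs⟩ := summable_iff_vanishing_norm.mp h (K / 2) (by positivity)
  have hbound : ∀ n : ℕ, 0 < n → K / 2 * (n : ℝ) ^ β ≤ s.card := by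
    intro n hn
    have hn' : (0 : ℝ) < n := by exact_mod_cast hn
    have hpow : (0 : ℝ) < (n : ℝ) ^ β := Real.rpow_pos_of_pos hn' _
    set T := (Finset.range (n + 1)).filter (· ∈ S)
    have hT : {m ∈ S | m ≤ n}.ncard = T.card := by
      rw [← Set.ncard_coe_finset]
      congr 1
      ext m
      simp [T, and_comm]
    have hc := hcard n hn
    rw [hT] at hc
    have hTs : (T.card : ℝ) ≤ (T \ s).card + s.card := by
      exact_mod_cast Finset.card_le_card_sdiff_add_card
    have htail := hs (T \ s) Finset.sdiff_disjoint
    have hlow : ((T \ s).card : ℝ) * (n : ℝ) ^ (-β) ≤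
        ∑ i ∈ T \ s, S.indicator (fun n : ℕ => (n : ℝ) ^ (-β)) i := by
      rw [← nsmul_eq_mul]
      refine Finset.card_nsmul_le_sum _ _ _ fun m hm => ?_
      obtain ⟨hmn, hmS⟩ := Finset.mem_filter.mp (Finset.mem_sdiff.mp hm).1
      rw [Set.indicator_of_mem hmS]
      have hm0 : 0 < m := Nat.pos_of_ne_zero fun hm0 => h0 (hm0 ▸ hmS)
      exact Real.rpow_le_rpow_of_nonpos (by exact_mod_cast hm0)
        (by exact_mod_cast Nat.lt_succ_iff.mp (Finset.mem_range.mp hmn)) (by linarith)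
    have hlt := hlow.trans_lt ((le_abs_self _).trans_lt htail)
    rw [Real.rpow_neg hn'.le, ← div_eq_mul_inv, div_lt_iff₀ hpow] at hlt
    linarith
  have htend : Tendsto (fun n : ℕ => K / 2 * (n : ℝ) ^ β) atTop atTop :=
    ((tendsto_rpow_atTop hβ).comp tendsto_natCast_atTop_atTop).const_mul_atTop (by positivity)
  obtain ⟨n, hn, hn0⟩ :=
    ((htend.eventually_gt_atTop (s.card : ℝ)).and (eventually_gt_atTop 0)).exists
  exact absurd (hbound n hn0) (not_le.mpr hn)

lemma finite_primeFactors_le (S : Set ℕ) (t : ℝ) :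
    {p ∈ PrimeFactors S | (p : ℝ) ≤ t}.Finite :=
  (Set.finite_Iic ⌊t⌋₊).subset fun _ hp => Nat.le_floor hp.2

lemma monotone_primesCountR (S : Set ℕ) : Monotone fun t : ℝ => (primesCountR S t : ℝ) := by
  intro a b hab
  exact Nat.cast_le.mpr (Set.ncard_le_ncard (fun p hp => ⟨hp.1, hp.2.trans hab⟩)
    (finite_primeFactors_le S b))

lemma intervalIntegrable_rpow_of_one_le (r : ℝ) {a b : ℝ} (ha : 1 ≤ a) (hab : a ≤ b) :
    IntervalIntegrable (fun t : ℝ => t ^ r) MeasureTheory.volume a b := by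
  refine intervalIntegral.intervalIntegrable_rpow (Or.inr fun h => ?_)
  rw [Set.uIcc_of_le hab] at h
  linarith [h.1]

lemma intervalIntegrable_indicator_Ici_rpow (r p : ℝ) {N : ℝ} (hN : 1 ≤ N) :
    IntervalIntegrable ((Set.Ici p).indicator fun t : ℝ => t ^ r) MeasureTheory.volume 1 N := by
  have h := intervalIntegrable_rpow_of_one_le r le_rfl hN
  exact ⟨h.1.indicator measurableSet_Ici, h.2.indicator measurableSet_Ici⟩

lemma le_integral_indicator_Ici_rpow {β p N : ℝ} (hβ : 0 < β) (hp : 1 ≤ p) (hpN : p ≤ N) :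
    (p ^ (-β) - N ^ (-β)) / β ≤
      ∫ t in (1 : ℝ)..N, (Set.Ici p).indicator (fun t : ℝ => t ^ (-(1 + β))) t := by
  have hintegrable := intervalIntegrable_indicator_Ici_rpow (-(1 + β)) p (hp.trans hpN)
  have hsplit := intervalIntegral.integral_add_adjacent_intervals
    (hintegrable.mono_set (c := 1) (d := p) (by
      rw [Set.uIcc_of_le hp, Set.uIcc_of_le (hp.trans hpN)]
      exact Set.Icc_subset_Icc_right hpN))
    (hintegrable.mono_set (c := p) (d := N) (by
      rw [Set.uIcc_of_le hpN, Set.uIcc_of_le (hp.trans hpN)]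
      exact Set.Icc_subset_Icc_left hp))
  have hfirst : 0 ≤ ∫ t in (1 : ℝ)..p,
      (Set.Ici p).indicator (fun t : ℝ => t ^ (-(1 + β))) t := by
    refine intervalIntegral.integral_nonneg hp fun t ht => ?_
    exact Set.indicator_apply_nonneg fun _ => Real.rpow_nonneg (by linarith [ht.1]) _
  have hsecond : ∫ t in p..N, (Set.Ici p).indicator (fun t : ℝ => t ^ (-(1 + β))) t =
      (p ^ (-β) - N ^ (-β)) / β := by
    rw [intervalIntegral.integral_congr (g := fun t : ℝ => t ^ (-(1 + β))) fun t ht => ?_,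
      integral_rpow (Or.inr ⟨by linarith, fun h => ?_⟩)]
    · rw [show -(1 + β) + 1 = -β by ring]
      field_simp
      ring
    · rw [Set.uIcc_of_le hpN] at h
      linarith [h.1]
    · rw [Set.uIcc_of_le hpN] at ht
      exact Set.indicator_of_mem (Set.mem_Ici.mpr ht.1) _
  linarith

/-- Every finite set of prime factors of elements of `S` bounds the weighted integral of the
prime counting function from below. -/
lemma sum_le_integral_primesCountR {β N : ℝ} (hβ : 0 < β) (hN : 1 ≤ N) {S : Set ℕ}
    {F : Finset ℕ} (hF : ∀ p ∈ F, p ∈ PrimeFactors S) (hFN : ∀ p ∈ F, (p : ℝ) ≤ N) :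
    ∑ p ∈ F, ((p : ℝ) ^ (-β) - N ^ (-β)) / β ≤
      ∫ t in (1 : ℝ)..N, (primesCountR S t : ℝ) * t ^ (-(1 + β)) := by
  classical
  calc ∑ p ∈ F, ((p : ℝ) ^ (-β) - N ^ (-β)) / β
      ≤ ∑ p ∈ F, ∫ t in (1 : ℝ)..N,
          (Set.Ici (p : ℝ)).indicator (fun t : ℝ => t ^ (-(1 + β))) t :=
        Finset.sum_le_sum fun p hp => le_integral_indicator_Ici_rpow hβ
          (by exact_mod_cast (hF p hp).1.one_le) (hFN p hp)
    _ = ∫ t in (1 : ℝ)..N, ∑ p ∈ F,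
          (Set.Ici (p : ℝ)).indicator (fun t : ℝ => t ^ (-(1 + β))) t :=
        (intervalIntegral.integral_finsetSum fun p _ =>
          intervalIntegrable_indicator_Ici_rpow _ _ hN).symm
    _ ≤ _ := by
        refine intervalIntegral.integral_mono_on hN
          (by
            simpa only [Finset.sum_fn] using IntervalIntegrable.sum F fun p _ =>
              intervalIntegrable_indicator_Ici_rpow (-(1 + β)) (p : ℝ) hN)
          ((monotone_primesCountR S).intervalIntegrable.mul_continuousOn fun t ht => ?_)
          fun t ht => ?_
        · rw [Set.uIcc_of_le hN] at ht
          exact (Real.continuousAt_rpow_const t _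
            (Or.inl (by linarith [ht.1]))).continuousWithinAt
        · have hle : (F.filter fun p : ℕ => (p : ℝ) ≤ t).card ≤ primesCountR S t := by
            rw [← Set.ncard_coe_finset]
            refine Set.ncard_le_ncard (fun p hp => ?_) (finite_primeFactors_le S t)
            obtain ⟨hpF, hpt⟩ := Finset.mem_filter.mp (Finset.mem_coe.mp hp)
            exact ⟨hF p hpF, hpt⟩
          simp only [Set.indicator_apply, Set.mem_Ici]
          rw [← Finset.sum_filter, Finset.sum_const, nsmul_eq_mul]
          exact mul_le_mul_of_nonneg_right (Nat.cast_le.mpr hle)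
            (Real.rpow_nonneg (by linarith [ht.1]) _)

theorem integral_primesCount_diverges (α : ℝ) (hα : 1 ≤ α) (S : Set ℕ)
    (hS : HasPolyDensity S α) :
    Filter.Tendsto
      (fun N : ℝ => ∫ t in (1 : ℝ)..N, (primesCountR S t : ℝ) * t ^ (-(1 + 1 / α)))
      Filter.atTop Filter.atTop := by
  classical
  have hα0 : 0 < α := by linarith
  have hdiv : ¬ Summable
      ((PrimeFactors S).indicator fun n : ℕ => (n : ℝ) ^ (-(1 / α))) := fun h =>
    hS.not_summable hα0
      (summable_indicator_of_summable_primeFactors (by positivity) hS.1 h)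
  set β := 1 / α
  have hβ : 0 < β := by positivity
  rw [not_summable_iff_tendsto_nat_atTop_of_nonneg
    (Set.indicator_nonneg fun n _ => Real.rpow_nonneg (Nat.cast_nonneg n) _)] at hdiv
  refine tendsto_atTop.mpr fun C => ?_
  obtain ⟨M, hM⟩ := (hdiv.eventually_gt_atTop (C * β)).exists
  set F := (Finset.range M).filter (· ∈ PrimeFactors S)
  have hFsum : C * β < ∑ p ∈ F, (p : ℝ) ^ (-β) := by
    simpa only [F, Finset.sum_filter, Set.indicator_apply] using hM
  have hlim : Tendsto (fun N : ℝ => ∑ p ∈ F, ((p : ℝ) ^ (-β) - N ^ (-β)) / β) atTop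
      (𝓝 (∑ p ∈ F, ((p : ℝ) ^ (-β) - 0) / β)) :=
    tendsto_finsetSum _ fun p _ => ((tendsto_rpow_neg_atTop hβ).const_sub _).div_const _
  have hC : C < ∑ p ∈ F, ((p : ℝ) ^ (-β) - 0) / β := by
    rw [← Finset.sum_div, lt_div_iff₀ hβ]
    simpa using hFsum
  filter_upwards [hlim.eventually (lt_mem_nhds hC), eventually_ge_atTop (1 : ℝ),
    eventually_ge_atTop (M : ℝ)] with N hN hN1 hNM
  refine hN.le.trans (sum_le_integral_primesCountR hβ hN1
    (fun p hp => (Finset.mem_filter.mp hp).2) fun p hp => le_trans ?_ hNM)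
  exact_mod_cast (Finset.mem_range.mp (Finset.mem_filter.mp hp).1).le
end

section
/- Let Q be a polynomial with integer coefficients of degree α ≥ 1, let π_Q(n) denote the number of primes p ≤ n such that p divides Q(m) for some positive integer m with Q(m) ≠ 0, and let r > 1 be a real number. Then π_Q(n) ≥ n^{1/α}/(log n)^r for infinitely many integers n ≥ 2. -/
/-- `π_Q(n)`: the number of primes `p ≤ n` dividing some nonzero value `Q(m)`, `m ≥ 1`. -/
noncomputable def polyPrimesCount (Q : Polynomial ℤ) (n : ℕ) : ℕ :=
  ({p : ℕ | p ≤ n ∧ p.Prime ∧ ∃ m : ℕ, 0 < m ∧ Q.eval (m : ℤ) ≠ 0 ∧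
    (p : ℤ) ∣ Q.eval (m : ℤ)}).ncard

/-- If the counting function of a set `P` of positive integers is eventually at most
`n ^ β / (log n) ^ r` with `1 < r`, then the sums `∑ p ^ (-β)` over finite subsets of `P` are
bounded. The sum is split into dyadic blocks. -/
lemma exists_sum_rpow_neg_le_of_ncard_le {P : Set ℕ} (hP : 0 ∉ P) {β r : ℝ} (hβ : 0 < β)
    (hr : 1 < r) (h : ∀ᶠ n : ℕ in Filter.atTop,
      (({p : ℕ | p ≤ n ∧ p ∈ P}.ncard : ℕ) : ℝ) ≤ (n : ℝ) ^ β / Real.log n ^ r) :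
    ∃ B : ℝ, ∀ T : Finset ℕ, (∀ p ∈ T, p ∈ P) → ∑ p ∈ T, (p : ℝ) ^ (-β) ≤ B := by
  set c : ℕ → ℝ := fun j ↦
    ({p : ℕ | p ≤ 2 ^ (j + 1) ∧ p ∈ P}.ncard : ℝ) * ((2 : ℝ) ^ j) ^ (-β) with hc
  have hc0 : ∀ j, 0 ≤ c j := fun j ↦ by positivity
  have hlog2 : 0 < Real.log 2 := Real.log_pos one_lt_two
  have hcs : Summable c := by
    have hs : Summable fun j : ℕ ↦ (2 : ℝ) ^ β / Real.log 2 ^ r * (((j + 1 : ℕ) : ℝ) ^ r)⁻¹ :=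
      ((summable_nat_add_iff 1).mpr (Real.summable_nat_rpow_inv.mpr hr)).mul_left _
    refine hs.of_norm_bounded_eventually_nat ?_
    have ht : Filter.Tendsto (fun j : ℕ ↦ 2 ^ (j + 1)) Filter.atTop Filter.atTop :=
      (tendsto_pow_atTop_atTop_of_one_lt one_lt_two).comp (Filter.tendsto_add_atTop_nat 1)
    filter_upwards [ht.eventually h] with j hj
    rw [Real.norm_of_nonneg (hc0 j), hc]
    refine (mul_le_mul_of_nonneg_right hj (by positivity)).trans_eq ?_
    push_cast
    rw [Real.log_pow, Real.mul_rpow (by positivity) hlog2.le, pow_succ,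
      Real.mul_rpow (by positivity) (by positivity), Real.rpow_neg (by positivity)]
    have : ((2 : ℝ) ^ j) ^ β ≠ 0 := by positivity
    push_cast
    field_simp
  refine ⟨∑' j, c j, fun T hT ↦ ?_⟩
  calc ∑ p ∈ T, (p : ℝ) ^ (-β)
      = ∑ j ∈ T.image (Nat.log 2), ∑ p ∈ T with Nat.log 2 p = j, (p : ℝ) ^ (-β) :=
        (Finset.sum_fiberwise_of_maps_to (fun _ ↦ Finset.mem_image_of_mem _) _).symm
    _ ≤ ∑ j ∈ T.image (Nat.log 2), c j := ?_
    _ ≤ ∑' j, c j := hcs.sum_le_tsum _ fun j _ ↦ hc0 j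
  refine Finset.sum_le_sum fun j _ ↦ ?_
  have hle : ∀ p ∈ T.filter (Nat.log 2 · = j), (p : ℝ) ^ (-β) ≤ ((2 : ℝ) ^ j) ^ (-β) := by
    intro p hp
    obtain ⟨hpT, rfl⟩ := Finset.mem_filter.mp hp
    have hp0 : p ≠ 0 := fun h0 ↦ hP (h0 ▸ hT p hpT)
    exact Real.rpow_le_rpow_of_nonpos (by positivity)
      (mod_cast Nat.pow_log_le_self 2 hp0) (by linarith)
  refine (Finset.sum_le_card_nsmul _ _ _ hle).trans ?_
  rw [nsmul_eq_mul, hc]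
  refine mul_le_mul_of_nonneg_right ?_ (by positivity)
  rw [Nat.cast_le, ← Set.ncard_coe_finset]
  refine Set.ncard_le_ncard ?_ ((Set.finite_Iic (2 ^ (j + 1))).subset fun p hp ↦ hp.1)
  intro p hp
  obtain ⟨hpT, rfl⟩ := Finset.mem_filter.mp (Finset.mem_coe.mp hp)
  exact ⟨(Nat.lt_pow_succ_log_self one_lt_two p).le, hT p hpT⟩

/-- A bound on `∑ p ^ (-β)` over a finite set `T` bounds `∑ n ^ (-β)` over `T`-factored
numbers, by comparing the Euler product with an exponential. -/
lemma sum_rpow_neg_le_exp_of_factoredNumbers {β B : ℝ} (hβ : 0 < β) {T : Finset ℕ}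
    (hT : ∀ p ∈ T, p.Prime) (hB : ∑ p ∈ T, (p : ℝ) ^ (-β) ≤ B) (A : Finset ℕ)
    (hA : ∀ n ∈ A, n ∈ Nat.factoredNumbers T) :
    ∑ n ∈ A, (n : ℝ) ^ (-β) ≤ Real.exp (B / (1 - 2 ^ (-β))) := by
  let f : ℕ →* ℝ :=
    { toFun := fun n ↦ (n : ℝ) ^ (-β)
      map_one' := by simp
      map_mul' := fun m n ↦ by
        push_cast
        exact Real.mul_rpow (by positivity) (by positivity) }
  have hq : (2 : ℝ) ^ (-β) < 1 := Real.rpow_lt_one_of_one_lt_of_neg one_lt_two (by linarith)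
  have hfp : ∀ {p : ℕ}, p.Prime → f p ≤ 2 ^ (-β) := fun {p} hp ↦
    Real.rpow_le_rpow_of_nonpos two_pos (mod_cast hp.two_le) (by linarith)
  have hf0 : ∀ n, 0 ≤ f n := fun n ↦ Real.rpow_nonneg (Nat.cast_nonneg n) _
  have hsum := (EulerProduct.summable_and_hasSum_factoredNumbers_prod_filter_prime_geometric
    (f := f) (fun {p} hp ↦ by
      rw [Real.norm_of_nonneg (hf0 p)]
      exact (hfp hp).trans_lt hq) T).2
  calc ∑ n ∈ A, (n : ℝ) ^ (-β)
      = ∑ n ∈ A.subtype (· ∈ Nat.factoredNumbers T), f n :=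
        (Finset.sum_subtype_of_mem f hA).symm
    _ ≤ ∏ p ∈ T with p.Prime, (1 - f p)⁻¹ :=
        sum_le_hasSum _ (fun n _ ↦ hf0 n) hsum
    _ = ∏ p ∈ T, (1 - f p)⁻¹ := by rw [Finset.filter_true_of_mem hT]
    _ ≤ ∏ p ∈ T, Real.exp (f p / (1 - 2 ^ (-β))) := by
        refine Finset.prod_le_prod (fun p hp ↦ ?_) fun p hp ↦ ?_
        · exact inv_nonneg.mpr (by linarith [hfp (hT p hp)])
        · have h1 := hfp (hT p hp)
          have h2 : 0 < 1 - f p := by linarith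
          calc (1 - f p)⁻¹ = f p / (1 - f p) + 1 := by field_simp; ring
            _ ≤ f p / (1 - 2 ^ (-β)) + 1 := by
                gcongr
                · exact hf0 p
            _ ≤ _ := Real.add_one_le_exp _
    _ = Real.exp ((∑ p ∈ T, f p) / (1 - 2 ^ (-β))) := by
        rw [← Real.exp_sum, Finset.sum_div]
    _ ≤ _ := Real.exp_le_exp.mpr (div_le_div_of_nonneg_right hB (by linarith))

namespace Polynomial

/-- A nonconstant integer polynomial takes each absolute value at most `2 * natDegree` times. -/
lemma card_filter_natAbs_eval_eq_le {Q : ℤ[X]} (hQ : 1 ≤ Q.natDegree) (A : Finset ℤ) (v : ℕ) :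
    (A.filter fun m ↦ (Q.eval m).natAbs = v).card ≤ 2 * Q.natDegree := by
  have hdeg : 0 < Q.degree := natDegree_pos_iff_degree_pos.mp hQ
  have hne : ∀ a : ℤ, Q - C a ≠ 0 := fun a h ↦ by
    rw [sub_eq_zero.mp h, natDegree_C] at hQ
    omega
  have hsub : (A.filter fun m ↦ (Q.eval m).natAbs = v) ⊆
      (Q - C (v : ℤ)).roots.toFinset ∪ (Q - C (-(v : ℤ))).roots.toFinset := by
    intro m hm
    have hv := (Finset.mem_filter.mp hm).2
    simp only [Finset.mem_union, Multiset.mem_toFinset, mem_roots (hne _), IsRoot.def, eval_sub,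
      eval_C]
    omega
  have hcard : ∀ a : ℤ, (Q - C a).roots.toFinset.card ≤ Q.natDegree := fun a ↦
    (Multiset.toFinset_card_le _).trans (card_roots_sub_C' hdeg)
  calc _ ≤ _ := Finset.card_le_card hsub
    _ ≤ _ := Finset.card_union_le _ _
    _ ≤ _ := by linarith [hcard v, hcard (-v)]

/-- An integer polynomial grows at most like its leading power on positive integers. -/
lemma natAbs_eval_le_mul_pow (Q : ℤ[X]) {m : ℕ} (hm : 1 ≤ m) :
    (Q.eval (m : ℤ)).natAbs ≤
      (∑ i ∈ Finset.range (Q.natDegree + 1), (Q.coeff i).natAbs) * m ^ Q.natDegree := by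
  rw [eval_eq_sum_range, Finset.sum_mul]
  refine (Int.natAbs_sum_le _ _).trans (Finset.sum_le_sum fun i hi ↦ ?_)
  rw [Int.natAbs_mul, Int.natAbs_pow, Int.natAbs_natCast]
  gcongr
  exact Nat.lt_succ_iff.mp (Finset.mem_range.mp hi)

/-- The series `∑ |Q(m)| ^ (-1 / deg Q)` over the positive integers diverges. -/
lemma not_summable_natAbs_eval_rpow {Q : ℤ[X]} (hQ : 1 ≤ Q.natDegree) :
    ¬ Summable fun m : ℕ ↦
      ((Q.eval ((m + 1 : ℕ) : ℤ)).natAbs : ℝ) ^ (-(1 / (Q.natDegree : ℝ))) := by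
  intro hs
  have hd : (0 : ℝ) < Q.natDegree := by exact_mod_cast hQ
  set K := ∑ i ∈ Finset.range (Q.natDegree + 1), (Q.coeff i).natAbs with hK
  have hQ0 : Q ≠ 0 := by rintro rfl; simp at hQ
  have hroots : ∀ᶠ m : ℕ in Filter.atTop, Q.eval ((m + 1 : ℕ) : ℤ) ≠ 0 := by
    have hinj : Function.Injective fun m : ℕ ↦ ((m + 1 : ℕ) : ℤ) := fun a b hab ↦ by
      simpa using hab
    have hfin := (Q.roots.toFinset.finite_toSet).preimage hinj.injOn
    rw [← Nat.cofinite_eq_atTop]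
    refine hfin.subset fun m hm ↦ ?_
    simpa [hQ0] using hm
  refine Real.not_summable_natCast_inv ((summable_nat_add_iff 1).mp ?_)
  refine (hs.mul_left ((K : ℝ) ^ (1 / (Q.natDegree : ℝ)))).of_norm_bounded_eventually_nat ?_
  filter_upwards [hroots] with m hm
  have hpos : (0 : ℝ) < (Q.eval ((m + 1 : ℕ) : ℤ)).natAbs := by
    exact_mod_cast Int.natAbs_pos.mpr hm
  have hle : ((Q.eval ((m + 1 : ℕ) : ℤ)).natAbs : ℝ) ≤ K * ((m + 1 : ℕ) : ℝ) ^ Q.natDegree := by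
    exact_mod_cast natAbs_eval_le_mul_pow Q (Nat.le_add_left 1 m)
  have hroot := Real.rpow_le_rpow hpos.le hle (one_div_nonneg.mpr hd.le)
  rw [Real.mul_rpow (by positivity) (by positivity), one_div,
    Real.pow_rpow_inv_natCast (by positivity) (by omega), ← one_div] at hroot
  rw [Real.norm_of_nonneg (by positivity), Real.rpow_neg hpos.le, ← div_eq_mul_inv,
    le_div_iff₀ (by positivity), inv_mul_le_iff₀ (by positivity), mul_comm]
  exact hroot

end Polynomial

theorem quantitative_gotchev (Q : Polynomial ℤ) (hQ : 1 ≤ Q.natDegree)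
    (r : ℝ) (hr : 1 < r) :
    {n : ℕ | 2 ≤ n ∧
      (n : ℝ) ^ (1 / (Q.natDegree : ℝ)) / (Real.log n) ^ r
        ≤ (polyPrimesCount Q n : ℝ)}.Infinite := by
  intro hfin
  have hd : (0 : ℝ) < Q.natDegree := by exact_mod_cast hQ
  set β : ℝ := 1 / (Q.natDegree : ℝ) with hβdef
  have hβ : 0 < β := one_div_pos.mpr hd
  set P : Set ℕ := {p : ℕ | p.Prime ∧ ∃ m : ℕ, 0 < m ∧ Q.eval (m : ℤ) ≠ 0 ∧
    (p : ℤ) ∣ Q.eval (m : ℤ)}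
  have hcount : ∀ᶠ n : ℕ in Filter.atTop,
      (({p : ℕ | p ≤ n ∧ p ∈ P}.ncard : ℕ) : ℝ) ≤ (n : ℝ) ^ β / Real.log n ^ r := by
    have hev := hfin.compl_mem_cofinite
    rw [Nat.cofinite_eq_atTop] at hev
    filter_upwards [hev, Filter.eventually_ge_atTop 2] with n hn hn2
    by_contra hlt
    exact hn ⟨hn2, (not_le.mp hlt).le⟩
  obtain ⟨B, hB⟩ := exists_sum_rpow_neg_le_of_ncard_le
    (fun h0 ↦ Nat.not_prime_zero h0.1) hβ hr hcount
  refine Polynomial.not_summable_natAbs_eval_rpow hQ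
    (summable_of_sum_le (c := 2 * Q.natDegree * Real.exp (B / (1 - 2 ^ (-β))))
      (fun m ↦ by positivity) fun A ↦ ?_)
  rw [← hβdef]
  set v : ℕ → ℕ := fun m ↦ (Q.eval ((m + 1 : ℕ) : ℤ)).natAbs
  set V : Finset ℕ := (A.image v).erase 0 with hV
  have hfactor : ∀ n ∈ V, ∀ p, p.Prime → p ∣ n → p ∈ P := by
    intro n hn p hp hpn
    obtain ⟨hn0, hn⟩ := Finset.mem_erase.mp hn
    obtain ⟨m, -, rfl⟩ := Finset.mem_image.mp hn
    exact ⟨hp, m + 1, m.succ_pos, Int.natAbs_ne_zero.mp hn0, Int.natCast_dvd.mpr hpn⟩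
  set T : Finset ℕ := V.biUnion Nat.primeFactors
  have hTP : ∀ p ∈ T, p ∈ P := by
    intro p hp
    obtain ⟨n, hn, hpn⟩ := Finset.mem_biUnion.mp hp
    exact hfactor n hn p (Nat.prime_of_mem_primeFactors hpn) (Nat.dvd_of_mem_primeFactors hpn)
  have hVsum := sum_rpow_neg_le_exp_of_factoredNumbers hβ (fun p hp ↦ (hTP p hp).1) (hB T hTP) V
    fun n hn ↦ Nat.mem_factoredNumbers_of_primeFactors_subset (Finset.ne_of_mem_erase hn)
      (Finset.subset_biUnion_of_mem Nat.primeFactors hn)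
  have hfiber : ∀ n, (A.filter (v · = n)).card ≤ 2 * Q.natDegree := by
    intro n
    have hinj : Function.Injective fun m : ℕ ↦ ((m + 1 : ℕ) : ℤ) := fun a b hab ↦ by
      simpa using hab
    refine le_trans ?_ (Polynomial.card_filter_natAbs_eval_eq_le hQ
      (A.image fun m : ℕ ↦ ((m + 1 : ℕ) : ℤ)) n)
    rw [Finset.filter_image, Finset.card_image_of_injective _ hinj]
  calc ∑ m ∈ A, (v m : ℝ) ^ (-β)
      = ∑ n ∈ A.image v, (A.filter (v · = n)).card • (n : ℝ) ^ (-β) :=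
        Finset.sum_comp (fun n : ℕ ↦ (n : ℝ) ^ (-β)) v
    _ ≤ ∑ n ∈ A.image v, 2 * Q.natDegree * (n : ℝ) ^ (-β) := by
        refine Finset.sum_le_sum fun n _ ↦ ?_
        rw [nsmul_eq_mul]
        gcongr
        exact_mod_cast hfiber n
    _ = 2 * Q.natDegree * ∑ n ∈ V, (n : ℝ) ^ (-β) := by
        rw [← Finset.mul_sum, hV, Finset.sum_erase]
        rw [Nat.cast_zero, Real.zero_rpow (by linarith)]
    _ ≤ _ := by gcongr
end
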